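/- arXiv:1811.01894 — 2 statements merged into one kernel-verified Lean document; each statement's English description precedes it below -/
import Mathlib

section
/- For s, t > 0 and λ > 0, the minimum over z > 0 of t(λ²/2 + zλ) + s·log((z+λ)/z) equals (λ/2)√(4st + (tλ)²) + s·log((2s + tλ² + λ√(4st + (tλ)²))/(2s)). -/
theorem lyapunov_exponent_min_closed_form (s t lam : ℝ) (hs : 0 < s) (ht : 0 < t)
    (hlam : 0 < lam) :
    IsLeast {y : ℝ | ∃ z > 0, y = t * (lam ^ 2 / 2 + z * lam) + s * Real.log ((z + lam) / z)}
      (lam / 2 * Real.sqrt (4 * s * t + (t * lam) ^ 2) +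
        s * Real.log ((2 * s + t * lam ^ 2 + lam * Real.sqrt (4 * s * t + (t * lam) ^ 2)) /
          (2 * s))) := by
  have hst : 0 < s * t := mul_pos hs ht
  have htl : 0 < t * lam := mul_pos ht hlam
  have hR2 : Real.sqrt (4 * s * t + (t * lam) ^ 2) ^ 2 = 4 * s * t + (t * lam) ^ 2 :=
    Real.sq_sqrt (by positivity)
  have hR0 := Real.sqrt_nonneg (4 * s * t + (t * lam) ^ 2)
  generalize Real.sqrt (4 * s * t + (t * lam) ^ 2) = R at hR2 hR0 ⊢
  have hRgt : t * lam < R := by nlinarith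
  obtain ⟨w, hw⟩ : ∃ w, w = (R - t * lam) / (2 * t) := ⟨_, rfl⟩
  have hw0 : 0 < w := by rw [hw]; apply div_pos <;> linarith
  have hR : R = 2 * t * w + t * lam := by rw [hw]; field_simp; ring
  have hsw : s = t * w * (w + lam) := by
    rw [hR] at hR2
    have : t * (s - t * w * (w + lam)) = 0 := by linarith
    rcases mul_eq_zero.mp this with h | h <;> linarith
  have hval : lam / 2 * R + s * Real.log ((2 * s + t * lam ^ 2 + lam * R) / (2 * s)) =
      t * (lam ^ 2 / 2 + w * lam) + s * Real.log ((w + lam) / w) := by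
    have h1 : (2 * s + t * lam ^ 2 + lam * R) / (2 * s) = (w + lam) / w := by
      rw [div_eq_div_iff (by positivity) (by positivity), hR, hsw]; ring
    rw [h1, hR]; ring
  rw [hval]
  refine ⟨⟨w, hw0, rfl⟩, ?_⟩
  rintro y ⟨z, hz, rfl⟩
  have hz : 0 < z := hz
  have hl := Real.one_sub_inv_le_log_of_pos
    (show 0 < ((z + lam) / z) / ((w + lam) / w) by positivity)
  rw [Real.log_div (by positivity) (by positivity)] at hl
  have h2 := mul_le_mul_of_nonneg_left hl hs.le
  have h3 : t * lam * (z - w) + s * (1 - (((z + lam) / z) / ((w + lam) / w))⁻¹) =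
      t * lam * (z - w) ^ 2 / (z + lam) := by
    rw [hsw]; field_simp; ring
  have h4 : 0 ≤ t * lam * (z - w) ^ 2 / (z + lam) := by positivity
  linarith
end

section
/- For μ > 0, λ ∈ (0, μ), and s, t > 0: max over r ∈ [0,t] of {r(λ²/2 + λμ) + Λ_{s,t−r}(λ)} = min of {t(λ²/2 + μλ) + s·log((μ+λ)/μ)} and min_{z ≥ μ} {t(λ²/2 + zλ) + s·log((z+λ)/z)}, where Λ_{s,u}(λ) := min_{z>0} {u(λ²/2 + zλ) + s·log((z+λ)/z)} for u > 0 and Λ_{s,0}(λ) := 0. -/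
/-- The point-to-point Lyapunov exponent `Λ_{s,u}(λ)` of Brownian directed percolation,
as the variational (minimal) value, extended by `Λ_{s,0}(λ) = 0`. -/
noncomputable def Lam (s lam u : ℝ) : ℝ :=
  if u = 0 then 0
  else sInf {y : ℝ | ∃ z > 0, y = u * (lam ^ 2 / 2 + z * lam) + s * Real.log ((z + lam) / z)}

lemma aux_key (lam s w z : ℝ) (hlam : 0 < lam) (hs : 0 < s) (hw : 0 < w) (hz : 0 < z) :
    s / (w * (w + lam)) * (lam ^ 2 / 2 + w * lam) + s * Real.log ((w + lam) / w) ≤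
    s / (w * (w + lam)) * (lam ^ 2 / 2 + z * lam) + s * Real.log ((z + lam) / z) := by
  have h1 : Real.log ((w + lam) / w) - Real.log ((z + lam) / z) ≤
      (w + lam) / w / ((z + lam) / z) - 1 := by
    rw [← Real.log_div (by positivity) (by positivity)]
    exact Real.log_le_sub_one_of_pos (by positivity)
  have h2 : (w + lam) / w / ((z + lam) / z) - 1 ≤ lam * (z - w) / (w * (w + lam)) := by
    have : lam * (z - w) / (w * (w + lam)) - ((w + lam) / w / ((z + lam) / z) - 1) =
        lam * (z - w) ^ 2 / (w * (w + lam) * (z + lam)) := by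
      have : w + lam ≠ 0 := by positivity
      have : z + lam ≠ 0 := by positivity
      field_simp
      ring
    have h3 : 0 ≤ lam * (z - w) ^ 2 / (w * (w + lam) * (z + lam)) := by positivity
    linarith
  have h3 := mul_le_mul_of_nonneg_left (h1.trans h2) hs.le
  have h4 : s * (lam * (z - w) / (w * (w + lam))) =
      s / (w * (w + lam)) * (lam ^ 2 / 2 + z * lam) -
      s / (w * (w + lam)) * (lam ^ 2 / 2 + w * lam) := by ring
  linarith

lemma aux_log (lam z : ℝ) (hlam : 0 < lam) (hz : 0 < z) : 0 ≤ Real.log ((z + lam) / z) := by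
  apply Real.log_nonneg
  rw [le_div_iff₀ hz]
  linarith

lemma aux_Lam (lam s w : ℝ) (hlam : 0 < lam) (hs : 0 < s) (hw : 0 < w) :
    s / (w * (w + lam)) * (lam ^ 2 / 2 + w * lam) + s * Real.log ((w + lam) / w) ≤
      Lam s lam (s / (w * (w + lam))) := by
  have h : s / (w * (w + lam)) ≠ 0 := by positivity
  unfold Lam
  rw [if_neg h]
  apply le_csInf
  · exact ⟨_, 1, one_pos, rfl⟩
  · rintro y ⟨z, hz, rfl⟩
    exact aux_key lam s w z hlam hs hw hz

lemma aux_Lam_le (lam s u z : ℝ) (hlam : 0 < lam) (hs : 0 < s) (hu : 0 ≤ u) (hz : 0 < z) :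
    Lam s lam u ≤ u * (lam ^ 2 / 2 + z * lam) + s * Real.log ((z + lam) / z) := by
  have hl := aux_log lam z hlam hz
  unfold Lam
  split_ifs with h
  · positivity
  · refine csInf_le ⟨0, ?_⟩ ⟨z, hz, rfl⟩
    rintro y ⟨x, hx, rfl⟩
    have hl := aux_log lam x hlam hx
    have hx : 0 < x := hx
    positivity

theorem stationary_max_over_exit_time (μ lam s t : ℝ) (hμ : 0 < μ) (hlam : 0 < lam)
    (hlt : lam < μ) (hs : 0 < s) (ht : 0 < t) :
    sSup {y : ℝ | ∃ r ∈ Set.Icc (0:ℝ) t,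
        y = r * (lam ^ 2 / 2 + lam * μ) + Lam s lam (t - r)} =
      min (t * (lam ^ 2 / 2 + μ * lam) + s * Real.log ((μ + lam) / μ))
        (sInf {y : ℝ | ∃ z ≥ μ,
          y = t * (lam ^ 2 / 2 + z * lam) + s * Real.log ((z + lam) / z)}) := by
  have hub : ∀ r ∈ Set.Icc (0:ℝ) t, ∀ z ≥ μ,
      r * (lam ^ 2 / 2 + lam * μ) + Lam s lam (t - r) ≤
        t * (lam ^ 2 / 2 + z * lam) + s * Real.log ((z + lam) / z) := by
    rintro r ⟨hr0, hrt⟩ z hz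
    have h := aux_Lam_le lam s (t - r) z hlam hs (by linarith) (by linarith)
    have h2 : 0 ≤ r * lam * (z - μ) := mul_nonneg (by positivity) (by linarith)
    nlinarith
  have hub2 : ∀ y ∈ {y : ℝ | ∃ r ∈ Set.Icc (0:ℝ) t,
        y = r * (lam ^ 2 / 2 + lam * μ) + Lam s lam (t - r)}, y ≤
      min (t * (lam ^ 2 / 2 + μ * lam) + s * Real.log ((μ + lam) / μ))
        (sInf {y : ℝ | ∃ z ≥ μ,
          y = t * (lam ^ 2 / 2 + z * lam) + s * Real.log ((z + lam) / z)}) := by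
    rintro y ⟨r, hr, rfl⟩
    refine le_min (hub r hr μ le_rfl) (le_csInf ⟨_, μ, le_rfl, rfl⟩ ?_)
    rintro y ⟨z, hz, rfl⟩
    exact hub r hr z hz
  apply le_antisymm
  · exact csSup_le ⟨_, 0, ⟨le_rfl, ht.le⟩, rfl⟩ hub2
  have hle : ∀ r ∈ Set.Icc (0:ℝ) t, r * (lam ^ 2 / 2 + lam * μ) + Lam s lam (t - r) ≤
      sSup {y : ℝ | ∃ r ∈ Set.Icc (0:ℝ) t,
        y = r * (lam ^ 2 / 2 + lam * μ) + Lam s lam (t - r)} :=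
    fun r hr => le_csSup ⟨_, hub2⟩ ⟨r, hr, rfl⟩
  rcases le_total s (t * (μ * (μ + lam))) with hc | hc
  · have hu : s / (μ * (μ + lam)) ≤ t := by
      rw [div_le_iff₀ (by positivity)]
      exact hc
    have hu0 : 0 ≤ s / (μ * (μ + lam)) := by positivity
    refine (min_le_left _ _).trans (le_trans ?_
      (hle (t - s / (μ * (μ + lam))) ⟨by linarith, by linarith⟩))
    rw [sub_sub_cancel]
    have h := aux_Lam lam s μ hlam hs hμ
    linarith
  · obtain ⟨w, hw, hwe⟩ : ∃ w, μ ≤ w ∧ t * (w * (w + lam)) = s := by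
      set q := Real.sqrt (lam ^ 2 + 4 * (s / t)) with hq
      have hq2 : q ^ 2 = lam ^ 2 + 4 * (s / t) := Real.sq_sqrt (by positivity)
      refine ⟨(q - lam) / 2, ?_, ?_⟩
      · have : 2 * μ + lam ≤ q := by
          apply Real.le_sqrt_of_sq_le
          have : μ * (μ + lam) ≤ s / t := by
            rw [le_div_iff₀ ht]
            linarith
          nlinarith
        linarith
      · have h : (q - lam) / 2 * ((q - lam) / 2 + lam) = s / t := by nlinarith
        rw [h]
        field_simp
    have hw0 : 0 < w := by linarith
    have hut : s / (w * (w + lam)) = t := by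
      rw [div_eq_iff (by positivity)]
      exact hwe.symm
    have h := aux_Lam lam s w hlam hs hw0
    rw [hut] at h
    have h0 := hle 0 ⟨le_rfl, ht.le⟩
    rw [sub_zero, zero_mul, zero_add] at h0
    refine (min_le_right _ _).trans (le_trans ?_ (h.trans h0))
    refine csInf_le ⟨0, ?_⟩ ⟨w, hw, rfl⟩
    rintro y ⟨x, hx, rfl⟩
    have hx : 0 < x := lt_of_lt_of_le hμ hx
    have hl := aux_log lam x hlam hx
    positivity
end
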